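/- For any AR(p) parameters φ_0 ∈ ℝ, φ_1, …, φ_p ∈ ℝ and σ > 0, there exist AT(p) parameters ϑ0 < ϑ1 and φ'_1, …, φ'_p ∈ ℝ such that for all y, y_{t−1}, …, y_{t−p} ∈ ℝ: ϑ0 + (ϑ1 − ϑ0)·y + Σ_{j=1}^p φ'_j·(ϑ0 + (ϑ1 − ϑ0)·y_{t−j}) = ( y − φ_0 − Σ_{j=1}^p φ_j·y_{t−j} ) / σ. In particular one may take ϑ1 − ϑ0 = σ^{−1}, φ'_j = −φ_j for all j, and ϑ0 = −φ_0 / (σ·(1 − Σ_{j=1}^p φ_j)) whenever Σ_{j=1}^p φ_j ≠ 1. -/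

import Mathlib

open Finset

/-- every AR(p) transformation `(y − φ_0 − Σ φ_j y_{t−j})/σ` (with `σ > 0`
and `Σ φ_j ≠ 1`) is realized by an AT(p) transformation with M = 1; in particular one may
take `ϑ1 − ϑ0 = σ⁻¹`, `φ'_j = −φ_j`, and `ϑ0 = −φ_0/(σ (1 − Σ φ_j))`. -/
theorem ar_p_realized_by_at_p
    (p : ℕ) (φ0 : ℝ) (φ : Fin p → ℝ) (σ : ℝ) (hσ : 0 < σ)
    (hsum : ∑ j, φ j ≠ 1) :
    ∃ (ϑ0 ϑ1 : ℝ) (φ' : Fin p → ℝ),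
      ϑ0 < ϑ1 ∧
      ϑ1 - ϑ0 = σ⁻¹ ∧
      (∀ j, φ' j = -(φ j)) ∧
      ϑ0 = -φ0 / (σ * (1 - ∑ j, φ j)) ∧
      ∀ (y : ℝ) (ylag : Fin p → ℝ),
        ϑ0 + (ϑ1 - ϑ0) * y + ∑ j, φ' j * (ϑ0 + (ϑ1 - ϑ0) * ylag j)
          = (y - φ0 - ∑ j, φ j * ylag j) / σ := by
  have hσ' : σ ≠ 0 := hσ.ne'
  have hs : 1 - ∑ j, φ j ≠ 0 := sub_ne_zero.mpr hsum.symm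
  refine ⟨-φ0 / (σ * (1 - ∑ j, φ j)), -φ0 / (σ * (1 - ∑ j, φ j)) + σ⁻¹, fun j => -φ j,
    lt_add_of_pos_right _ (inv_pos.mpr hσ), add_sub_cancel_left _ _, fun _ => rfl, rfl, ?_⟩
  intro y ylag
  have key (a b : ℝ) : ∑ j, -φ j * (a + b * ylag j)
      = -(a * ∑ j, φ j) - b * ∑ j, φ j * ylag j := by
    rw [mul_sum, mul_sum, ← sum_neg_distrib, ← sum_sub_distrib]
    exact sum_congr rfl fun j _ => by ring
  rw [add_sub_cancel_left, key]
  field_simp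
  ring
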